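/- The fundamental group of the complement in ℝ³ of the standard round unknot (the unit circle in the xy-plane) is infinite cyclic, i.e. isomorphic to ℤ. -/

import Mathlib

open Set unitInterval

section Topology

variable {X : Type*} [TopologicalSpace X] {x y z : X}

local notation "⟪" γ "⟫" => Path.Homotopic.Quotient.mk γ

/-- Two paths with the same endpoints in a simply connected set are homotopic. -/
theorem IsSimplyConnected.mk_eq_mk {U : Set X} (hU : IsSimplyConnected U) {γ γ' : Path x y}
    (hγ : ∀ t, γ t ∈ U) (hγ' : ∀ t, γ' t ∈ U) : ⟪γ⟫ = ⟪γ'⟫ := by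
  have := hU.simplyConnectedSpace
  have hx : x ∈ U := by simpa using hγ 0
  have hy : y ∈ U := by simpa using hγ 1
  let lift (δ : Path x y) (hδ : ∀ t, δ t ∈ U) : Path (⟨x, hx⟩ : U) ⟨y, hy⟩ :=
    { toFun := fun t ↦ ⟨δ t, hδ t⟩
      source' := by simp
      target' := by simp }
  exact Path.Homotopic.Quotient.eq.mpr
    ((SimplyConnectedSpace.paths_homotopic (lift γ hγ) (lift γ' hγ')).map
      ⟨Subtype.val, continuous_subtype_val⟩)

theorem Path.Homotopic.Quotient.symm_trans_cancel_left (γ : Path.Homotopic.Quotient x y)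
    (δ : Path.Homotopic.Quotient y z) : γ.symm.trans (γ.trans δ) = δ := by
  rw [← Path.Homotopic.Quotient.trans_assoc]
  simp

theorem Path.Homotopic.Quotient.trans_symm_cancel_left (γ : Path.Homotopic.Quotient x y)
    (δ : Path.Homotopic.Quotient x z) : γ.trans (γ.symm.trans δ) = δ := by
  rw [← Path.Homotopic.Quotient.trans_assoc]
  simp

/-- A property of paths which is stable under homotopy and concatenation holds for all paths as
soon as it holds for the paths contained in some member of a given open cover. -/
theorem Path.Homotopic.Quotient.induction_of_open_cover {ι : Type*} {U : ι → Set X}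
    (hU : ∀ i, IsOpen (U i)) (hcover : ∀ x, ∃ i, x ∈ U i)
    {P : ∀ {x y : X}, Path.Homotopic.Quotient x y → Prop}
    (htrans : ∀ {x y z : X} (γ : Path.Homotopic.Quotient x y) (δ : Path.Homotopic.Quotient y z),
      P γ → P δ → P (γ.trans δ))
    (hloc : ∀ i {x y : X} (γ : Path x y), (∀ t, γ t ∈ U i) → P ⟪γ⟫)
    (γ : Path x y) : P ⟪γ⟫ := by
  obtain ⟨t, t_zero, t_mono, ⟨n, hn⟩, ht⟩ :=
    exists_monotone_Icc_subset_open_cover_unitInterval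
      (fun i ↦ (hU i).preimage γ.continuous) fun s _ ↦ by simpa using hcover (γ s)
  have key : ∀ k, P ⟪γ.subpath 0 (t k)⟫ := by
    intro k
    induction k with
    | zero =>
      obtain ⟨i, hi⟩ := hcover (γ 0)
      rw [t_zero, Path.subpath_self]
      exact hloc i _ fun _ ↦ hi
    | succ k ih =>
      have hsub : ⟪γ.subpath 0 (t (k + 1))⟫
          = (⟪γ.subpath 0 (t k)⟫).trans ⟪γ.subpath (t k) (t (k + 1))⟫ := by
        rw [← Path.Homotopic.Quotient.mk_trans, Path.Homotopic.Quotient.eq]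
        exact ⟨(Path.Homotopy.subpathTransSubpath γ 0 (t k) (t (k + 1))).symm⟩
      rw [hsub]
      refine htrans _ _ ih ?_
      obtain ⟨i, hi⟩ := ht k
      refine hloc i _ fun s ↦ ?_
      have hs := mem_range_self (f := γ.subpath (t k) (t (k + 1))) s
      rw [Path.range_subpath_of_le _ _ _ (t_mono k.le_succ)] at hs
      obtain ⟨u, hu, hus⟩ := hs
      exact hus ▸ hi hu
  have h := key n
  rw [hn n le_rfl, Path.subpath_zero_one] at h
  have aux : ∀ {x' y' : X} (hx : x' = x) (hy : y' = y), P ⟪γ.cast hx hy⟫ → P ⟪γ⟫ := by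
    rintro _ _ rfl rfl h
    exact h
  exact aux _ _ h

theorem Path.trans_mem {U : Set X} {γ : Path x y} {δ : Path y z} (hγ : ∀ t, γ t ∈ U)
    (hδ : ∀ t, δ t ∈ U) (t : I) : γ.trans δ t ∈ U := by
  have ht := mem_range_self (f := γ.trans δ) t
  rw [Path.trans_range] at ht
  rcases ht with ⟨s, hs⟩ | ⟨s, hs⟩
  · exact hs ▸ hγ s
  · exact hs ▸ hδ s

/-- Let `X` be covered by simply connected open sets containing a base point `x`. A subgroup of
`π₁(X, x)` is everything as soon as it contains all loops going from `x` to some `y` inside one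
member of the cover and back to `x` inside another one. -/
theorem FundamentalGroup.subgroup_eq_top_of_open_cover {ι : Type*} {U : ι → Set X}
    (hU : ∀ i, IsOpen (U i)) (hcover : ∀ x, ∃ i, x ∈ U i) (hsc : ∀ i, IsSimplyConnected (U i))
    (hx : ∀ i, x ∈ U i) (K : Subgroup (FundamentalGroup X x))
    (hK : ∀ i j y, ∀ α β : Path x y, (∀ t, α t ∈ U i) → (∀ t, β t ∈ U j) →
      .fromPath ((⟪α⟫).trans (⟪β⟫).symm) ∈ K) :
    K = ⊤ := by
  have hpath (y : X) : ∃ i, ∃ α : Path x y, ∀ t, α t ∈ U i := by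
    obtain ⟨i, hi⟩ := hcover y
    exact ⟨i, (hsc i).isPathConnected.joinedIn x (hx i) y hi⟩
  choose idx c hc using hpath
  have key {y z : X} (γ : Path y z) :
      FundamentalGroup.fromPath (((⟪c y⟫).trans ⟪γ⟫).trans (⟪c z⟫).symm) ∈ K := by
    refine Path.Homotopic.Quotient.induction_of_open_cover hU hcover
      (P := fun {y z} γ ↦ FundamentalGroup.fromPath (((⟪c y⟫).trans γ).trans (⟪c z⟫).symm) ∈ K)
      ?_ ?_ γ
    · intro x y z γ δ hγ hδ
      have h : (((⟪c x⟫).trans γ).trans (⟪c y⟫).symm).trans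
          (((⟪c y⟫).trans δ).trans (⟪c z⟫).symm)
          = ((⟪c x⟫).trans (γ.trans δ)).trans (⟪c z⟫).symm := by
        simp [Path.Homotopic.Quotient.symm_trans_cancel_left]
      exact h ▸ K.mul_mem hδ hγ
    · intro i y z γ hγ
      have hy : y ∈ U i := by simpa using hγ 0
      obtain ⟨α, hα⟩ := (hsc i).isPathConnected.joinedIn x (hx i) y hy
      have h : ((⟪c y⟫).trans (⟪α⟫).symm).trans ((⟪α.trans γ⟫).trans (⟪c z⟫).symm)
          = ((⟪c y⟫).trans ⟪γ⟫).trans (⟪c z⟫).symm := by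
        simp [Path.Homotopic.Quotient.symm_trans_cancel_left]
      exact h ▸ K.mul_mem (hK _ _ _ _ _ (Path.trans_mem hα hγ) (hc z)) (hK _ _ _ _ _ (hc y) hα)
  have hcx : FundamentalGroup.fromPath ⟪c x⟫ ∈ K := by
    have h : (⟪c x⟫).trans (⟪Path.refl x⟫).symm = ⟪c x⟫ := by
      rw [← Path.Homotopic.Quotient.mk_symm, Path.refl_symm]
      simp
    exact h ▸ hK _ (idx x) _ (c x) (Path.refl x) (hc x) fun _ ↦ hx _
  refine eq_top_iff.mpr fun g _ ↦ ?_
  obtain ⟨γ, rfl⟩ := Path.Homotopic.Quotient.mk_surjective g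
  have h : (⟪c x⟫).symm.trans ((((⟪c x⟫).trans ⟪γ⟫).trans (⟪c x⟫).symm).trans ⟪c x⟫) = ⟪γ⟫ := by
    simp [Path.Homotopic.Quotient.symm_trans_cancel_left]
  exact h ▸ K.mul_mem (K.mul_mem hcx (key γ)) (K.inv_mem hcx)

/-- Going out inside `U` and back inside `V` gives a loop whose class only depends on the path
component of `U ∩ V` in which the turning point lies. -/
theorem IsSimplyConnected.mk_trans_symm_eq {U V C : Set X} (hU : IsSimplyConnected U)
    (hV : IsSimplyConnected V) (hC : IsPathConnected C) (hCU : C ⊆ U) (hCV : C ⊆ V)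
    (hy : y ∈ C) (hz : z ∈ C) {α β : Path x y} {α' β' : Path x z}
    (hα : ∀ t, α t ∈ U) (hβ : ∀ t, β t ∈ V) (hα' : ∀ t, α' t ∈ U) (hβ' : ∀ t, β' t ∈ V) :
    (⟪α⟫).trans (⟪β⟫).symm = (⟪α'⟫).trans (⟪β'⟫).symm := by
  obtain ⟨δ, hδ⟩ := hC.joinedIn y hy z hz
  rw [← hU.mk_eq_mk (Path.trans_mem hα fun t ↦ hCU (hδ t)) hα',
    ← hV.mk_eq_mk (Path.trans_mem hβ fun t ↦ hCV (hδ t)) hβ',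
    Path.Homotopic.Quotient.mk_trans, Path.Homotopic.Quotient.mk_trans]
  have h : ((⟪β⟫).trans ⟪δ⟫).symm = (⟪δ⟫).symm.trans (⟪β⟫).symm := by
    rw [← Path.Homotopic.Quotient.mk_trans, ← Path.Homotopic.Quotient.mk_symm, Path.trans_symm,
      Path.Homotopic.Quotient.mk_trans, Path.Homotopic.Quotient.mk_symm,
      Path.Homotopic.Quotient.mk_symm]
  rw [h]
  simp [Path.Homotopic.Quotient.trans_symm_cancel_left]

theorem IsSimplyConnected.mk_trans_symm_eq_one {U V C : Set X} (hU : IsSimplyConnected U)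
    (hV : IsSimplyConnected V) (hC : IsPathConnected C) (hCU : C ⊆ U) (hCV : C ⊆ V)
    (hx : x ∈ C) (hy : y ∈ C) {α β : Path x y} (hα : ∀ t, α t ∈ U) (hβ : ∀ t, β t ∈ V) :
    FundamentalGroup.fromPath ((⟪α⟫).trans (⟪β⟫).symm) = 1 := by
  rw [hU.mk_trans_symm_eq hV hC hCU hCV hy hx hα hβ (α' := .refl x) (β' := .refl x)
    (fun _ ↦ hCU hx) (fun _ ↦ hCV hx)]
  exact Path.Homotopic.Quotient.trans_symm _

end Topology

section Circle

theorem infinite_fundamentalGroup_circle (w : Circle) : Infinite (FundamentalGroup Circle w) := by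
  obtain ⟨t, ht⟩ := Circle.isAddQuotientCoveringMap_exp.surjective w
  have e := Circle.isAddQuotientCoveringMap_exp.fundamentalGroupEquiv (x := w) ⟨t, ht⟩
  have hinf : Infinite (AddSubgroup.zmultiples (2 * Real.pi)) :=
    (infinite_zmultiples.mpr (not_isOfFinAddOrder_of_isAddTorsionFree
      (by positivity))).to_subtype
  have : Infinite (Multiplicative (AddSubgroup.zmultiples (2 * Real.pi)))ᵐᵒᵖ :=
    (Multiplicative.ofAdd.trans MulOpposite.opEquiv).infinite_iff.mp hinf
  exact e.toEquiv.infinite_iff.mpr this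

variable {X Y : Type*} [TopologicalSpace X] [TopologicalSpace Y]

/-- A continuous map with a continuous left inverse is injective on fundamental groups. -/
theorem FundamentalGroup.map_injective_of_leftInverse {s : C(Y, X)} {f : C(X, Y)}
    (h : Function.LeftInverse f s) (y : Y) : Function.Injective (FundamentalGroup.map s y) := by
  intro a b hab
  obtain ⟨γ, rfl⟩ := Path.Homotopic.Quotient.mk_surjective a
  obtain ⟨δ, rfl⟩ := Path.Homotopic.Quotient.mk_surjective b
  have hγδ : (γ.map s.continuous).Homotopic (δ.map s.continuous) :=
    Path.Homotopic.Quotient.eq.mp hab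
  have := (hγδ.map f).pathCast (h y).symm (h y).symm
  refine Path.Homotopic.Quotient.eq.mpr ?_
  convert! this using 1 <;> ext t <;> simp [h _]

end Circle

section Unknot

local notation "E³" => EuclideanSpace ℝ (Fin 3)

/-- The cylindrical coordinates `(ρ, z)` of a point of `ℝ³`. -/
noncomputable def cylindrical (p : E³) : ℝ × ℝ := (√(p 0 ^ 2 + p 1 ^ 2), p 2)

theorem continuous_cylindrical : Continuous cylindrical := by
  unfold cylindrical
  fun_prop

theorem cylindrical_fst_nonneg (p : E³) : 0 ≤ (cylindrical p).1 := Real.sqrt_nonneg _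

/-- Polar coordinates in horizontal planes are compatible with `cylindrical`. -/
theorem cylindrical_polar {r : ℝ} (hr : 0 ≤ r) (θ z : ℝ) :
    cylindrical !₂[r * Real.cos θ, r * Real.sin θ, z] = (r, z) := by
  have h : (r * Real.cos θ) ^ 2 + (r * Real.sin θ) ^ 2 = r ^ 2 := by
    linear_combination r ^ 2 * Real.sin_sq_add_cos_sq θ
  simp [cylindrical, h, Real.sqrt_sq hr]

theorem exists_eq_polar (p : E³) :
    ∃ θ, p = !₂[(cylindrical p).1 * Real.cos θ, (cylindrical p).1 * Real.sin θ,
      (cylindrical p).2] := by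
  have hnorm : ‖(⟨p 0, p 1⟩ : ℂ)‖ = (cylindrical p).1 := by
    rw [Complex.norm_def, Complex.normSq_mk, cylindrical]
    ring_nf
  refine ⟨Complex.arg ⟨p 0, p 1⟩, ?_⟩
  ext i
  fin_cases i
  · simp [← hnorm, Complex.norm_mul_cos_arg]
  · simp [← hnorm, Complex.norm_mul_sin_arg]
  · simp [cylindrical]

/-- The solid of revolution with convex profile `D` is path connected. -/
theorem isPathConnected_preimage_cylindrical {D : Set (ℝ × ℝ)} (hD : Convex ℝ D)
    (hne : ∃ d ∈ D, 0 ≤ d.1) : IsPathConnected (cylindrical ⁻¹' D) := by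
  have hconv : Convex ℝ ((D ∩ {d | 0 ≤ d.1}) ×ˢ (univ : Set ℝ)) :=
    (hD.inter (convex_halfSpace_ge (LinearMap.fst ℝ ℝ ℝ).isLinear 0)).prod convex_univ
  obtain ⟨d, hd, hd0⟩ := hne
  have hpc := (hconv.isPathConnected ⟨(d, 0), ⟨hd, hd0⟩, mem_univ _⟩).image
    (f := fun x : (ℝ × ℝ) × ℝ ↦ (!₂[x.1.1 * Real.cos x.2, x.1.1 * Real.sin x.2, x.1.2] : E³))
    (by fun_prop)
  convert! hpc using 1
  ext p
  constructor
  · intro hp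
    obtain ⟨θ, hθ⟩ := exists_eq_polar p
    exact ⟨(cylindrical p, θ), ⟨⟨hp, cylindrical_fst_nonneg p⟩, mem_univ _⟩, hθ.symm⟩
  · rintro ⟨⟨⟨r, z⟩, θ⟩, ⟨⟨hx, hr⟩, -⟩, rfl⟩
    rw [mem_preimage, cylindrical_polar hr]
    exact hx

/-- The standard round unknot. -/
def unknot : Set E³ := {p | p 2 = 0 ∧ p 0 ^ 2 + p 1 ^ 2 = 1}

theorem mem_unknot_iff {p : E³} : p ∈ unknot ↔ cylindrical p = (1, 0) := by
  simp [unknot, cylindrical, Real.sqrt_eq_one, and_comm]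

/-- The part of the complement of the unknot with profile `D`. -/
def profile (D : Set (ℝ × ℝ)) : Set ↥unknotᶜ := {p | cylindrical p ∈ D}

theorem isOpen_profile {D : Set (ℝ × ℝ)} (hD : IsOpen D) : IsOpen (profile D) :=
  hD.preimage (continuous_cylindrical.comp continuous_subtype_val)

theorem image_profile {D : Set (ℝ × ℝ)} (hD : (1, 0) ∉ D) :
    (Subtype.val '' profile D) = cylindrical ⁻¹' D := by
  ext p
  constructor
  · rintro ⟨q, hq, rfl⟩
    exact hq
  · intro hp
    exact ⟨⟨p, fun h ↦ hD (mem_unknot_iff.mp h ▸ hp)⟩, hp, rfl⟩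

theorem isPathConnected_profile {D : Set (ℝ × ℝ)} (hD : Convex ℝ D) (hD' : (1, 0) ∉ D)
    (hne : ∃ d ∈ D, 0 ≤ d.1) : IsPathConnected (profile D) := by
  rw [Topology.IsInducing.subtypeVal.isPathConnected_iff, image_profile hD']
  exact isPathConnected_preimage_cylindrical hD hne

theorem isSimplyConnected_profile {D : Set (ℝ × ℝ)} (hD : (1, 0) ∉ D) {c : ℝ}
    (hc : (0, c) ∈ D)
    (hstar : ∀ d ∈ D, 0 ≤ d.1 → ∀ s : ℝ, 0 < s → s ≤ 1 → (s * d.1, (1 - s) * c + s * d.2) ∈ D) :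
    IsSimplyConnected (profile D) := by
  rw [← Topology.IsEmbedding.subtypeVal.isSimplyConnected_image, image_profile hD]
  have hc' : !₂[0, 0, c] ∈ cylindrical ⁻¹' D := by simpa [cylindrical] using hc
  have hst : StarConvex ℝ (!₂[0, 0, c] : E³) (cylindrical ⁻¹' D) := by
    intro p hp a b ha hb hab
    obtain rfl : a = 1 - b := by linarith
    rcases hb.eq_or_lt with rfl | hb'
    · simpa using hc'
    have hcyl : cylindrical ((1 - b) • !₂[0, 0, c] + b • p)
        = (b * (cylindrical p).1, (1 - b) * c + b * (cylindrical p).2) := by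
      have h : (b * p 0) ^ 2 + (b * p 1) ^ 2 = b ^ 2 * (p 0 ^ 2 + p 1 ^ 2) := by ring
      simp [cylindrical, h, Real.sqrt_mul (sq_nonneg b), Real.sqrt_sq hb]
    rw [mem_preimage, hcyl]
    exact hstar _ hp (cylindrical_fst_nonneg p) b hb' (by linarith)
  have := hst.contractibleSpace ⟨_, hc'⟩
  exact SimplyConnectedSpace.ofContractible ↥(cylindrical ⁻¹' D)

/-- Profile of the upper half-space together with the outside of the cone `ρ ≤ 1 - z`. -/
def upperProfile : Set (ℝ × ℝ) := {d | 0 < d.2 ∨ 1 - d.2 < d.1}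

/-- Mirror image of `upperProfile`. -/
def lowerProfile : Set (ℝ × ℝ) := {d | d.2 < 0 ∨ 1 + d.2 < d.1}

/-- Profile of the complement of the part of the plane `z = 0` outside the open unit disk. -/
def innerProfile : Set (ℝ × ℝ) := {d | d.2 ≠ 0 ∨ d.1 < 1}

theorem isSimplyConnected_upperProfile : IsSimplyConnected (profile upperProfile) := by
  refine isSimplyConnected_profile (c := 1) (by norm_num [upperProfile])
    (by norm_num [upperProfile]) ?_
  rintro ⟨r, z⟩ h hr s hs hs1
  simp only [upperProfile, mem_ofPred_eq] at h hr ⊢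
  rcases h with h | h
  · left
    nlinarith [mul_pos hs h]
  · right
    nlinarith [mul_lt_mul_of_pos_left h hs]

theorem isSimplyConnected_lowerProfile : IsSimplyConnected (profile lowerProfile) := by
  refine isSimplyConnected_profile (c := -1) (by norm_num [lowerProfile])
    (by norm_num [lowerProfile]) ?_
  rintro ⟨r, z⟩ h hr s hs hs1
  simp only [lowerProfile, mem_ofPred_eq] at h hr ⊢
  rcases h with h | h
  · left
    nlinarith [mul_pos_of_neg_of_neg (neg_neg_of_pos hs) h]
  · right
    nlinarith [mul_lt_mul_of_pos_left h hs]

theorem isSimplyConnected_innerProfile : IsSimplyConnected (profile innerProfile) := by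
  refine isSimplyConnected_profile (c := 0) (by norm_num [innerProfile])
    (by norm_num [innerProfile]) ?_
  rintro ⟨r, z⟩ h hr s hs hs1
  simp only [innerProfile, mem_ofPred_eq] at h hr ⊢
  rcases h with h | h
  · exact .inl (by simp [hs.ne', h])
  · right
    nlinarith

theorem convex_halfPlane {s : Set (ℝ × ℝ)} (a b c : ℝ) (h : ∀ d, d ∈ s ↔ a * d.1 + b * d.2 < c) :
    Convex ℝ s := by
  have hs : s = {d | (a • LinearMap.fst ℝ ℝ ℝ + b • LinearMap.snd ℝ ℝ ℝ) d < c} := by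
    ext d
    simp [h]
  exact hs ▸ convex_halfSpace_lt (LinearMap.isLinear _) c

theorem convex_lt_snd : Convex ℝ {d : ℝ × ℝ | 0 < d.2} :=
  convex_halfPlane 0 (-1) 0 fun d ↦ by simp

theorem convex_snd_lt : Convex ℝ {d : ℝ × ℝ | d.2 < 0} :=
  convex_halfPlane 0 1 0 fun d ↦ by simp

theorem convex_one_sub_lt : Convex ℝ {d : ℝ × ℝ | 1 - d.2 < d.1} :=
  convex_halfPlane (-1) (-1) (-1) fun d ↦ by
    simp only [mem_ofPred_eq]
    constructor <;> intro <;> linarith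

theorem convex_one_add_lt : Convex ℝ {d : ℝ × ℝ | 1 + d.2 < d.1} :=
  convex_halfPlane (-1) 1 (-1) fun d ↦ by
    simp only [mem_ofPred_eq]
    constructor <;> intro <;> linarith

theorem isOpen_upperProfile : IsOpen upperProfile :=
  (show IsOpen {d : ℝ × ℝ | 0 < d.2} from isOpen_lt (by fun_prop) (by fun_prop)).union
    (show IsOpen {d : ℝ × ℝ | 1 - d.2 < d.1} from isOpen_lt (by fun_prop) (by fun_prop))

theorem isOpen_lowerProfile : IsOpen lowerProfile :=
  (show IsOpen {d : ℝ × ℝ | d.2 < 0} from isOpen_lt (by fun_prop) (by fun_prop)).union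
    (show IsOpen {d : ℝ × ℝ | 1 + d.2 < d.1} from isOpen_lt (by fun_prop) (by fun_prop))

theorem isOpen_innerProfile : IsOpen innerProfile :=
  (show IsOpen {d : ℝ × ℝ | d.2 ≠ 0} from isOpen_ne_fun (by fun_prop) (by fun_prop)).union
    (show IsOpen {d : ℝ × ℝ | d.1 < 1} from isOpen_lt (by fun_prop) (by fun_prop))

theorem exists_cylindrical_eq {r z : ℝ} (hr : 0 ≤ r) (h : (r, z) ≠ (1, 0)) :
    ∃ p : ↥unknotᶜ, cylindrical p = (r, z) :=
  ⟨⟨_, fun h' ↦ h ((cylindrical_polar hr 0 z).symm.trans (mem_unknot_iff.mp h'))⟩,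
    cylindrical_polar hr 0 z⟩

theorem mem_profile_upper_or_inner (p : ↥unknotᶜ) :
    p ∈ profile upperProfile ∨ p ∈ profile innerProfile := by
  have hp := mem_unknot_iff.not.mp p.2
  by_cases h : p ∈ profile innerProfile
  · exact .inr h
  · refine .inl (.inr ?_)
    simp only [profile, innerProfile, mem_ofPred_eq, not_or, not_not, not_lt] at h
    rw [h.1, sub_zero]
    exact h.2.lt_of_ne fun h' ↦ hp (Prod.ext h'.symm h.1)

section Generator

local notation "⟪" γ "⟫" => Path.Homotopic.Quotient.mk γ

theorem exists_zpowers_eq_top {x : ↥unknotᶜ} (hx : cylindrical x = (3, 1)) :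
    ∃ g : FundamentalGroup ↥unknotᶜ x, Subgroup.zpowers g = ⊤ := by
  let U : Fin 3 → Set ↥unknotᶜ :=
    ![profile upperProfile, profile lowerProfile, profile innerProfile]
  have hU : ∀ i, IsOpen (U i) := by
    intro i
    fin_cases i
    exacts [isOpen_profile isOpen_upperProfile, isOpen_profile isOpen_lowerProfile,
      isOpen_profile isOpen_innerProfile]
  have hcover : ∀ y, ∃ i, y ∈ U i := fun y ↦
    (mem_profile_upper_or_inner y).elim (fun h ↦ ⟨0, h⟩) fun h ↦ ⟨2, h⟩
  have hsc : ∀ i, IsSimplyConnected (U i) := by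
    intro i
    fin_cases i
    exacts [isSimplyConnected_upperProfile, isSimplyConnected_lowerProfile,
      isSimplyConnected_innerProfile]
  have hxU : ∀ i, x ∈ U i := by
    intro i
    fin_cases i <;> norm_num [U, profile, hx, upperProfile, lowerProfile, innerProfile]
  obtain ⟨x', hx'⟩ := exists_cylindrical_eq (r := 3) (z := -1) (by norm_num) (by norm_num)
  -- The intersection of the upper and the lower set is path connected, whereas each of them
  -- meets the inner set in two path components, which are distinguished by the sign of `z`.
  let F : Set (ℝ × ℝ) := {d | 1 - d.2 < d.1} ∩ {d | 1 + d.2 < d.1}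
  let P : Set (ℝ × ℝ) := {d | 0 < d.2}
  let N : Set (ℝ × ℝ) := {d | d.2 < 0}
  let P' : Set (ℝ × ℝ) := {d | 0 < d.2} ∩ {d | 1 + d.2 < d.1}
  let N' : Set (ℝ × ℝ) := {d | d.2 < 0} ∩ {d | 1 - d.2 < d.1}
  have hF : IsPathConnected (profile F) :=
    isPathConnected_profile (convex_one_sub_lt.inter convex_one_add_lt) (by norm_num [F])
      ⟨(3, 1), by norm_num [F], by norm_num⟩
  have hP : IsPathConnected (profile P) :=
    isPathConnected_profile convex_lt_snd (by norm_num [P]) ⟨(3, 1), by norm_num [P], by norm_num⟩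
  have hN : IsPathConnected (profile N) :=
    isPathConnected_profile convex_snd_lt (by norm_num [N]) ⟨(3, -1), by norm_num [N], by norm_num⟩
  have hP' : IsPathConnected (profile P') :=
    isPathConnected_profile (convex_lt_snd.inter convex_one_add_lt) (by norm_num [P'])
      ⟨(3, 1), by norm_num [P'], by norm_num⟩
  have hN' : IsPathConnected (profile N') :=
    isPathConnected_profile (convex_snd_lt.inter convex_one_sub_lt) (by norm_num [N'])
      ⟨(3, -1), by norm_num [N'], by norm_num⟩
  have hFU : profile F ⊆ profile upperProfile := fun y hy ↦ .inr hy.1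
  have hFL : profile F ⊆ profile lowerProfile := fun y hy ↦ .inr hy.2
  have hPU : profile P ⊆ profile upperProfile := fun y hy ↦ .inl hy
  have hPI : profile P ⊆ profile innerProfile := fun y hy ↦ .inl hy.ne'
  have hNL : profile N ⊆ profile lowerProfile := fun y hy ↦ .inl hy
  have hNI : profile N ⊆ profile innerProfile := fun y hy ↦ .inl hy.ne
  have hPL' : profile P' ⊆ profile lowerProfile := fun y hy ↦ .inr hy.2
  have hPI' : profile P' ⊆ profile innerProfile := fun y hy ↦ .inl hy.1.ne'
  have hNU' : profile N' ⊆ profile upperProfile := fun y hy ↦ .inr hy.2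
  have hNI' : profile N' ⊆ profile innerProfile := fun y hy ↦ .inl hy.1.ne
  obtain ⟨a, ha⟩ := hF.joinedIn x (by norm_num [F, profile, hx]) x' (by norm_num [F, profile, hx'])
  obtain ⟨b, hb⟩ := (hsc 2).isPathConnected.joinedIn x (hxU 2) x'
    (show cylindrical x' ∈ innerProfile by norm_num [innerProfile, hx'])
  let K := Subgroup.zpowers (FundamentalGroup.fromPath ((⟪a⟫).trans (⟪b⟫).symm))
  have hab : FundamentalGroup.fromPath ((⟪a⟫).trans (⟪b⟫).symm) ∈ K := Subgroup.mem_zpowers _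
  have hswap {y} {α β : Path x y} (h : FundamentalGroup.fromPath ((⟪α⟫).trans (⟪β⟫).symm) ∈ K) :
      FundamentalGroup.fromPath ((⟪β⟫).trans (⟪α⟫).symm) ∈ K := by
    have h' : ((⟪α⟫).trans (⟪β⟫).symm).symm = (⟪β⟫).trans (⟪α⟫).symm := by
      rw [← Path.Homotopic.Quotient.mk_symm, ← Path.Homotopic.Quotient.mk_trans,
        ← Path.Homotopic.Quotient.mk_symm, Path.trans_symm, Path.symm_symm,
        Path.Homotopic.Quotient.mk_trans, Path.Homotopic.Quotient.mk_symm]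
    exact h' ▸ K.inv_mem h
  have hUL {y} {α β : Path x y} (hα : ∀ t, α t ∈ profile upperProfile)
      (hβ : ∀ t, β t ∈ profile lowerProfile) :
      FundamentalGroup.fromPath ((⟪α⟫).trans (⟪β⟫).symm) ∈ K := by
    have h₁ : y ∈ profile upperProfile := by simpa using hα 1
    have h₂ : y ∈ profile lowerProfile := by simpa using hβ 1
    have hy : y ∈ profile F := by
      simp only [profile, upperProfile, lowerProfile, F, mem_ofPred_eq, mem_inter_iff] at h₁ h₂ ⊢
      grind
    rw [isSimplyConnected_upperProfile.mk_trans_symm_eq_one isSimplyConnected_lowerProfile hF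
      hFU hFL (by norm_num [F, profile, hx]) hy hα hβ]
    exact K.one_mem
  have hUI {y} {α β : Path x y} (hα : ∀ t, α t ∈ profile upperProfile)
      (hβ : ∀ t, β t ∈ profile innerProfile) :
      FundamentalGroup.fromPath ((⟪α⟫).trans (⟪β⟫).symm) ∈ K := by
    have h₁ : y ∈ profile upperProfile := by simpa using hα 1
    have h₂ : y ∈ profile innerProfile := by simpa using hβ 1
    have hy : y ∈ profile P ∨ y ∈ profile N' := by
      simp only [profile, upperProfile, innerProfile, P, N', mem_ofPred_eq, mem_inter_iff]
        at h₁ h₂ ⊢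
      grind
    rcases hy with hy | hy
    · rw [isSimplyConnected_upperProfile.mk_trans_symm_eq_one isSimplyConnected_innerProfile hP
        hPU hPI (by norm_num [P, profile, hx]) hy hα hβ]
      exact K.one_mem
    · rwa [isSimplyConnected_upperProfile.mk_trans_symm_eq isSimplyConnected_innerProfile hN'
        hNU' hNI' hy (by norm_num [N', profile, hx']) hα hβ (fun t ↦ hFU (ha t)) hb]
  have hLI {y} {α β : Path x y} (hα : ∀ t, α t ∈ profile lowerProfile)
      (hβ : ∀ t, β t ∈ profile innerProfile) :
      FundamentalGroup.fromPath ((⟪α⟫).trans (⟪β⟫).symm) ∈ K := by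
    have h₁ : y ∈ profile lowerProfile := by simpa using hα 1
    have h₂ : y ∈ profile innerProfile := by simpa using hβ 1
    have hy : y ∈ profile P' ∨ y ∈ profile N := by
      simp only [profile, lowerProfile, innerProfile, P', N, mem_ofPred_eq, mem_inter_iff]
        at h₁ h₂ ⊢
      grind
    rcases hy with hy | hy
    · rw [isSimplyConnected_lowerProfile.mk_trans_symm_eq_one isSimplyConnected_innerProfile hP'
        hPL' hPI' (by norm_num [P', profile, hx]) hy hα hβ]
      exact K.one_mem
    · rwa [isSimplyConnected_lowerProfile.mk_trans_symm_eq isSimplyConnected_innerProfile hN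
        hNL hNI hy (by norm_num [N, profile, hx']) hα hβ (fun t ↦ hFL (ha t)) hb]
  have hdiag (i) {y} {α β : Path x y} (hα : ∀ t, α t ∈ U i) (hβ : ∀ t, β t ∈ U i) :
      FundamentalGroup.fromPath ((⟪α⟫).trans (⟪β⟫).symm) ∈ K := by
    rw [(hsc i).mk_eq_mk hα hβ, Path.Homotopic.Quotient.trans_symm]
    exact K.one_mem
  refine ⟨_, FundamentalGroup.subgroup_eq_top_of_open_cover hU hcover hsc hxU K ?_⟩
  intro i j y α β hα hβ
  fin_cases i <;> fin_cases j
  exacts [hdiag 0 hα hβ, hUL hα hβ, hUI hα hβ, hswap (hUL hβ hα), hdiag 1 hα hβ, hLI hα hβ,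
    hswap (hUI hβ hα), hswap (hLI hβ hα), hdiag 2 hα hβ]

end Generator

theorem pathConnectedSpace_compl_unknot : PathConnectedSpace ↥unknotᶜ := by
  have h : (univ : Set ↥unknotᶜ) = profile upperProfile ∪ profile innerProfile :=
    (eq_univ_of_forall mem_profile_upper_or_inner).symm
  obtain ⟨y, hy⟩ := exists_cylindrical_eq (r := 0) (z := 1) le_rfl (by simp)
  rw [pathConnectedSpace_iff_univ, h]
  exact isSimplyConnected_upperProfile.isPathConnected.union
    isSimplyConnected_innerProfile.isPathConnected
    ⟨y, by simp [profile, upperProfile, hy], by simp [profile, innerProfile, hy]⟩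

theorem cylindrical_vertical_circle (w : Circle) :
    cylindrical !₂[1 + (w : ℂ).re / 2, 0, (w : ℂ).im / 2]
      = (1 + (w : ℂ).re / 2, (w : ℂ).im / 2) := by
  have hre : -1 ≤ (w : ℂ).re := (abs_le.mp ((Complex.abs_re_le_norm w).trans_eq w.norm_coe)).1
  simpa using cylindrical_polar (r := 1 + (w : ℂ).re / 2) (by linarith) 0 ((w : ℂ).im / 2)

/-- The circle of radius `1 / 2` around a point of the unknot, in a half-plane bounded by the
axis. -/
noncomputable def meridian : C(Circle, ↥unknotᶜ) where
  toFun w := ⟨!₂[1 + (w : ℂ).re / 2, 0, (w : ℂ).im / 2], by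
    rw [mem_compl_iff, mem_unknot_iff, cylindrical_vertical_circle]
    intro h
    have hw : (w : ℂ) = 0 := by
      obtain ⟨hre, him⟩ := Prod.mk.inj h
      apply Complex.ext <;> simp <;> linarith
    exact w.coe_ne_zero hw⟩
  continuous_toFun := by fun_prop

/-- The displacement, in the half-plane bounded by the axis, from the unknot to a point. -/
noncomputable def displacement (p : E³) : ℂ := ⟨(cylindrical p).1 - 1, (cylindrical p).2⟩

theorem displacement_ne_zero (p : ↥unknotᶜ) : displacement p ≠ 0 := by
  intro h
  refine p.2 (mem_unknot_iff.mpr (Prod.ext ?_ ?_))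
  · simpa [displacement, sub_eq_zero] using congrArg Complex.re h
  · simpa [displacement] using congrArg Complex.im h

theorem continuous_displacement : Continuous displacement := by
  have h : displacement = fun p ↦ Complex.equivRealProdCLM.symm (cylindrical p - (1, 0)) := by
    ext p
    apply Complex.ext <;> simp [displacement]
  rw [h]
  exact Complex.equivRealProdCLM.symm.continuous.comp (continuous_cylindrical.sub continuous_const)

/-- The angular coordinate around the unknot. -/
noncomputable def meridianAngle : C(↥unknotᶜ, Circle) where
  toFun p := ⟨displacement p / ‖displacement p‖, by
    have := norm_ne_zero_iff.mpr (displacement_ne_zero p)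
    simp [Submonoid.unitSphere, this]⟩
  continuous_toFun := by
    have h := continuous_displacement.comp (continuous_subtype_val (p := (· ∈ unknotᶜ)))
    refine Continuous.subtype_mk (h.div (Complex.continuous_ofReal.comp h.norm) fun p ↦ ?_) _
    simpa using displacement_ne_zero p

theorem meridianAngle_leftInverse : Function.LeftInverse meridianAngle meridian := by
  intro w
  have h : displacement (meridian w) = w / 2 := by
    change displacement !₂[1 + (w : ℂ).re / 2, 0, (w : ℂ).im / 2] = _
    rw [displacement, cylindrical_vertical_circle]
    apply Complex.ext <;> simp
  ext
  change displacement (meridian w) / ‖displacement (meridian w)‖ = w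
  rw [h, norm_div, w.norm_coe]
  simp

theorem nonempty_fundamentalGroup_compl_unknot_mulEquiv (x₀ : ↥unknotᶜ) :
    Nonempty (FundamentalGroup ↥unknotᶜ x₀ ≃* Multiplicative ℤ) := by
  have := pathConnectedSpace_compl_unknot
  obtain ⟨x, hx⟩ := exists_cylindrical_eq (r := 3) (z := 1) (by norm_num) (by norm_num)
  obtain ⟨g, hg⟩ := exists_zpowers_eq_top hx
  have := infinite_fundamentalGroup_circle 1
  have := Infinite.of_injective _
    (FundamentalGroup.map_injective_of_leftInverse meridianAngle_leftInverse 1)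
  have : Infinite (FundamentalGroup ↥unknotᶜ x) :=
    (FundamentalGroup.fundamentalGroupMulEquivOfPathConnected
      (meridian 1) x).toEquiv.infinite_iff.mp this
  exact ⟨(FundamentalGroup.fundamentalGroupMulEquivOfPathConnected x₀ x).trans
    (intEquivOfZPowersEqTop g hg).symm⟩

end Unknot

/-- The fundamental group of the complement in ℝ³ of the standard round unknot
(the unit circle in the xy-plane) is infinite cyclic, i.e. isomorphic to ℤ. -/
theorem unknot_complement_fundamentalGroup_infinite_cyclic
    (S : Set (EuclideanSpace ℝ (Fin 3)))
    (hS : S = {p : EuclideanSpace ℝ (Fin 3) | p 2 = 0 ∧ (p 0) ^ 2 + (p 1) ^ 2 = 1})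
    (x₀ : ↥(Sᶜ)) :
    Nonempty (FundamentalGroup (↥(Sᶜ)) x₀ ≃* Multiplicative ℤ) := by
  subst hS
  exact nonempty_fundamentalGroup_compl_unknot_mulEquiv x₀
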